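/- Let φ:(R,m,K)→(S,n,L) be a flat local homomorphism of Noetherian local rings of prime characteristic p with S/mS Gorenstein. Let z_1,…,z_d ∈ S be elements whose images form a system of parameters in S/mS, and write (z)^[t] = (z_1^t,…,z_d^t)S. Let I ⊆ R be an ideal with ℓ(R/I) < ∞ and dim_K((I :_R m)/I) = 1 which is Frobenius closed in R. If some c ∈ S − mS is a test element for S and S/mS is F-rational, then IS + (z)^[t] is tightly closed in S for every t > 0. -/

import Mathlib

open IsLocalRing

/-- The Frobenius power `I^[q]` of an ideal: the ideal generated by the `q`-th powers
of the elements of `I`. -/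
def Ideal.frobPow {R : Type*} [CommRing R] (I : Ideal R) (q : ℕ) : Ideal R :=
  Ideal.span ((fun x : R => x ^ q) '' (I : Set R))

/-- `R°`: the complement in `R` of the union of the minimal primes of `R`. -/
def circComplement (R : Type*) [CommRing R] : Set R :=
  {c : R | ∀ P ∈ minimalPrimes R, c ∉ P}

/-- `x ∈ I*`: tight closure membership (`p` is the characteristic). -/
def MemTightClosure {R : Type*} [CommRing R] (p : ℕ) (I : Ideal R) (x : R) : Prop :=
  ∃ c ∈ circComplement R, ∃ N : ℕ, ∀ e : ℕ, N ≤ e → c * x ^ p ^ e ∈ I.frobPow (p ^ e)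

/-- An ideal is tightly closed if `I* = I`. -/
def Ideal.IsTightlyClosed {R : Type*} [CommRing R] (p : ℕ) (I : Ideal R) : Prop :=
  ∀ x : R, MemTightClosure p I x → x ∈ I

/-- An ideal is Frobenius closed if `x^q ∈ I^[q]` for some `q` implies `x ∈ I`. -/
def Ideal.IsFrobeniusClosed {R : Type*} [CommRing R] (p : ℕ) (I : Ideal R) : Prop :=
  ∀ x : R, (∃ e : ℕ, x ^ p ^ e ∈ I.frobPow (p ^ e)) → x ∈ I

/-- A ring is weakly F-regular if every ideal is tightly closed. -/
def IsWeaklyFRegular (R : Type*) [CommRing R] (p : ℕ) : Prop :=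
  ∀ I : Ideal R, I.IsTightlyClosed p

/-- A test element: an element of `R°` that works in every tight closure test. -/
def IsTestElement {R : Type*} [CommRing R] (p : ℕ) (c : R) : Prop :=
  c ∈ circComplement R ∧
    ∀ (I : Ideal R) (x : R), MemTightClosure p I x → ∀ e : ℕ, c * x ^ p ^ e ∈ I.frobPow (p ^ e)

/-- A (full) system of parameters of a local ring: `dim R` elements of the maximal
ideal generating an ideal whose radical is the maximal ideal. -/
def IsSystemOfParameters (R : Type*) [CommRing R] [IsLocalRing R] {n : ℕ} (x : Fin n → R) : Prop :=
  ringKrullDim R = n ∧ (∀ i, x i ∈ maximalIdeal R) ∧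
    maximalIdeal R ≤ (Ideal.span (Set.range x)).radical

/-- A parameter ideal: an ideal generated by part of a system of parameters. -/
def Ideal.IsParameterIdeal {R : Type*} [CommRing R] [IsLocalRing R] (I : Ideal R) : Prop :=
  ∃ (n k : ℕ) (h : k ≤ n) (x : Fin n → R), IsSystemOfParameters R x ∧
    I = Ideal.span (Set.range fun i : Fin k => x (Fin.castLE h i))

/-- A local ring is F-rational if every parameter ideal is tightly closed. -/
def IsFRational (R : Type*) [CommRing R] [IsLocalRing R] (p : ℕ) : Prop :=
  ∀ I : Ideal R, I.IsParameterIdeal → I.IsTightlyClosed p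

/-- A local ring is F-injective if every parameter ideal is Frobenius closed. -/
def IsFInjective (R : Type*) [CommRing R] [IsLocalRing R] (p : ℕ) : Prop :=
  ∀ I : Ideal R, I.IsParameterIdeal → I.IsFrobeniusClosed p

/-- A local ring is Cohen-Macaulay if some system of parameters is a regular sequence. -/
def IsCohenMacaulayLocalRing (R : Type*) [CommRing R] [IsLocalRing R] : Prop :=
  ∃ (n : ℕ) (x : Fin n → R), IsSystemOfParameters R x ∧
    RingTheory.Sequence.IsRegular R (List.ofFn x)

/-- An irreducible ideal: a proper ideal that is not the intersection of two
strictly larger ideals. -/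
def Ideal.IsIrreducible {R : Type*} [CommRing R] (I : Ideal R) : Prop :=
  I ≠ ⊤ ∧ ∀ A B : Ideal R, I = A ⊓ B → I = A ∨ I = B

/-- A local ring is Gorenstein if it is Cohen-Macaulay and some system of parameters
generates an irreducible ideal. -/
def IsGorensteinLocalRing (R : Type*) [CommRing R] [IsLocalRing R] : Prop :=
  ∃ (n : ℕ) (x : Fin n → R), IsSystemOfParameters R x ∧
    RingTheory.Sequence.IsRegular R (List.ofFn x) ∧
    (Ideal.span (Set.range x)).IsIrreducible

/-- The socle `(I :_R m)/I` of `R ⧸ I` is one-dimensional over the residue field,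
with (the image of) `u` as a generator. -/
def GeneratesSocle {R : Type*} [CommRing R] [IsLocalRing R] (I : Ideal R) (u : R) : Prop :=
  u ∈ Submodule.colon I (maximalIdeal R) ∧ u ∉ I ∧
    ∀ v ∈ Submodule.colon I (maximalIdeal R), ∃ r : R, v - r * u ∈ I

/-- `dim_K ((I :_R m)/I) = 1`: the socle of `R ⧸ I` is one-dimensional over the
residue field. -/
def SocleDimOne {R : Type*} [CommRing R] [IsLocalRing R] (I : Ideal R) : Prop :=
  ∃ u : R, GeneratesSocle I u

/-- `rs` is a regular sequence modulo `J`. -/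
def Ideal.IsRegularModulo {A : Type*} [CommRing A] (J : Ideal A) : List A → Prop
  | [] => True
  | r :: rs => (∀ s, r * s ∈ J → s ∈ J) ∧ (J ⊔ Ideal.span {r}).IsRegularModulo rs

namespace Ideal.IsRegularModulo

variable {A : Type*} [CommRing A]

theorem append_iff (J : Ideal A) (l₁ l₂ : List A) :
    J.IsRegularModulo (l₁ ++ l₂) ↔
      J.IsRegularModulo l₁ ∧ (J ⊔ Ideal.ofList l₁).IsRegularModulo l₂ := by
  induction l₁ generalizing J with
  | nil => simp [IsRegularModulo]
  | cons r rs ih =>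
    simp only [List.cons_append, IsRegularModulo, ih, Ideal.ofList_cons, sup_assoc, and_assoc]

theorem append_singleton_iff (J : Ideal A) (l : List A) (r : A) :
    J.IsRegularModulo (l ++ [r]) ↔
      J.IsRegularModulo l ∧ ∀ s, r * s ∈ J ⊔ Ideal.ofList l → s ∈ J ⊔ Ideal.ofList l := by
  simp [append_iff, IsRegularModulo]

theorem swap [IsNoetherianRing A] [IsLocalRing A] {J : Ideal A} {a b : A} {l : List A}
    (ha : a ∈ maximalIdeal A) (h : J.IsRegularModulo (a :: b :: l)) :
    J.IsRegularModulo (b :: a :: l) := by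
  obtain ⟨h₁, h₂, h₃⟩ := h
  refine ⟨?_, ?_, by rwa [sup_right_comm]⟩
  · let N : Ideal A := Submodule.comap (LinearMap.mulLeft A b) J
    have hN : ∀ s, s ∈ N ↔ b * s ∈ J := fun s => Iff.rfl
    have key : N ≤ J ⊔ maximalIdeal A • N := by
      intro s hs
      obtain ⟨j, hj, w, hw, rfl⟩ := Submodule.mem_sup.mp (h₂ s (Ideal.mem_sup_left hs))
      obtain ⟨s', rfl⟩ := Ideal.mem_span_singleton.mp hw
      refine Submodule.add_mem_sup hj (Submodule.smul_mem_smul ha ((hN s').mpr (h₁ _ ?_)))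
      have : b * (j + a * s') - b * j ∈ J := J.sub_mem hs (J.mul_mem_left b hj)
      convert this using 1; ring
    have := Submodule.le_of_le_smul_of_le_jacobson_bot (IsNoetherian.noetherian N)
      (IsLocalRing.maximalIdeal_le_jacobson ⊥) key
    exact fun s hs => this hs
  · intro s hs
    obtain ⟨j, hj, w, hw, e⟩ := Submodule.mem_sup.mp hs
    obtain ⟨s', rfl⟩ := Ideal.mem_span_singleton.mp hw
    have hs' : s' ∈ J ⊔ Ideal.span {a} := h₂ s' <| by
      have : b * s' = a * s - j := by rw [← e]; ring
      rw [this]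
      exact sub_mem (Ideal.mem_sup_right (Ideal.mem_span_singleton.mpr ⟨s, rfl⟩))
        (Ideal.mem_sup_left hj)
    obtain ⟨j', hj', w', hw', rfl⟩ := Submodule.mem_sup.mp hs'
    obtain ⟨s'', rfl⟩ := Ideal.mem_span_singleton.mp hw'
    have : s - b * s'' ∈ J := h₁ _ <| by
      have : a * (s - b * s'') = j + b * j' := by linear_combination -e
      rw [this]
      exact J.add_mem hj (J.mul_mem_left b hj')
    rw [← sub_add_cancel s (b * s'')]
    exact Submodule.add_mem_sup this (Ideal.mem_span_singleton.mpr ⟨s'', rfl⟩)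

theorem perm [IsNoetherianRing A] [IsLocalRing A] {l₁ l₂ : List A} (h : l₁.Perm l₂)
    {J : Ideal A} (hl : ∀ a ∈ l₁, a ∈ maximalIdeal A) (h₁ : J.IsRegularModulo l₁) :
    J.IsRegularModulo l₂ := by
  induction h generalizing J with
  | nil => exact h₁
  | cons a _ ih => exact ⟨h₁.1, ih (fun b hb => hl b (by simp [hb])) h₁.2⟩
  | swap a b l => exact swap (hl _ (by simp)) h₁
  | trans p _ ih₁ ih₂ => exact ih₂ (fun a ha => hl a (p.mem_iff.mpr ha)) (ih₁ hl h₁)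

theorem comap_iff {B : Type*} [CommRing B] {f : A →+* B} (hf : Function.Surjective f)
    (J : Ideal B) (l : List A) :
    (J.comap f).IsRegularModulo l ↔ J.IsRegularModulo (l.map f) := by
  induction l generalizing J with
  | nil => simp [IsRegularModulo]
  | cons r rs ih =>
    have : J.comap f ⊔ Ideal.span {r} = (J ⊔ Ideal.span {f r}).comap f := by
      have hmap : J ⊔ Ideal.span {f r} = (J.comap f ⊔ Ideal.span {r}).map f := by
        rw [Ideal.map_sup, Ideal.map_comap_of_surjective f hf, Ideal.map_span, Set.image_singleton]
      rw [hmap, Ideal.comap_map_of_surjective' f hf, left_eq_sup]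
      exact le_sup_of_le_left (Ideal.comap_mono bot_le)
    simp only [IsRegularModulo, List.map_cons, this, ih, Ideal.mem_comap, map_mul, hf.forall]

theorem of_isWeaklyRegular {l : List A} (h : RingTheory.Sequence.IsWeaklyRegular A l) :
    (⊥ : Ideal A).IsRegularModulo l := by
  suffices ∀ l₁ l₂ : List A, l = l₁ ++ l₂ → (Ideal.ofList l₁).IsRegularModulo l₂ by
    simpa using this [] l rfl
  intro l₁ l₂ e
  induction l₂ generalizing l₁ with
  | nil => trivial
  | cons r rs ih =>
    refine ⟨?_, ?_⟩
    · have := h.regular_mod_prev l₁.length (by simp [e])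
      subst e
      simpa [isSMulRegular_quotient_iff_mem_of_smul_mem] using this
    · have := ih (l₁ ++ [r]) (by simp [e])
      simpa [Ideal.ofList_append] using this

theorem regular_of_pow_mem {K : Ideal A} {x y : A} (hx : ∀ s, x * s ∈ K → s ∈ K) {n : ℕ}
    (hn : x ^ n ∈ K ⊔ Ideal.span {y}) : ∀ s, y * s ∈ K → s ∈ K := by
  intro s hs
  have hxn : ∀ k : ℕ, x ^ k * s ∈ K → s ∈ K := by
    intro k
    induction k with
    | zero => simp
    | succ k ih => exact fun h => ih (hx _ (by rwa [← mul_assoc, ← pow_succ']))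
  refine hxn n ?_
  obtain ⟨j, hj, w, hw, e⟩ := Submodule.mem_sup.mp hn
  obtain ⟨a, rfl⟩ := Ideal.mem_span_singleton.mp hw
  have : x ^ n * s = s * j + a * (y * s) := by rw [← e]; ring
  rw [this]
  exact K.add_mem (K.mul_mem_left _ hj) (K.mul_mem_left _ hs)

end Ideal.IsRegularModulo

section
variable {A : Type*} [CommRing A] [IsNoetherianRing A] [IsLocalRing A]

theorem maximalIdeal_le_radical_of_notMem_minimalPrimes {K : Ideal A} {x y : A}
    (hx : x ∈ maximalIdeal A)
    (hxK : maximalIdeal A ≤ (K ⊔ Ideal.span {x}).radical)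
    (hy : ∀ P ∈ K.minimalPrimes, y ∉ P) :
    maximalIdeal A ≤ (K ⊔ Ideal.span {y}).radical := by
  rw [Ideal.radical_eq_sInf, le_sInf_iff]
  rintro Q ⟨hQ, hQp⟩
  by_contra hlt
  have hQm : Q < maximalIdeal A :=
    lt_of_le_not_ge (IsLocalRing.le_maximalIdeal hQp.ne_top) hlt
  have hKQ : K ≤ Q := le_sup_left.trans hQ
  have hspan : Ideal.span (insert x (K : Set A)) = K ⊔ Ideal.span {x} := by
    rw [Ideal.span_insert, Ideal.span_eq, sup_comm]
  have hmin : maximalIdeal A ∈ (Ideal.span (insert x (K : Set A))).minimalPrimes := by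
    rw [hspan]
    exact ⟨⟨inferInstance, sup_le (hKQ.trans hQm.le)
      ((Ideal.span_singleton_le_iff_mem _).mpr hx)⟩,
      fun P' hP' _ => hxK.trans (hP'.1.radical_le_iff.mpr hP'.2)⟩
  have := Ideal.mem_minimalPrimes_span_of_mem_minimalPrimes_span_insert hQm x K hmin K hKQ
    (fun s hs => hspan ▸ Ideal.le_radical (Ideal.mem_sup_left hs))
  rw [Ideal.span_eq] at this
  exact hy Q this (hQ (Ideal.mem_sup_right (Ideal.mem_span_singleton_self y)))

theorem exists_common_parameter {K₁ K₂ : Ideal A} {x z : A}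
    (hx : x ∈ maximalIdeal A) (hz : z ∈ maximalIdeal A)
    (hxK : maximalIdeal A ≤ (K₁ ⊔ Ideal.span {x}).radical)
    (hzK : maximalIdeal A ≤ (K₂ ⊔ Ideal.span {z}).radical)
    (h₁ : ¬ maximalIdeal A ≤ K₁.radical) (h₂ : ¬ maximalIdeal A ≤ K₂.radical) :
    ∃ y ∈ maximalIdeal A, maximalIdeal A ≤ (K₁ ⊔ Ideal.span {y}).radical ∧
      maximalIdeal A ≤ (K₂ ⊔ Ideal.span {y}).radical := by
  have aux : ∀ K : Ideal A, ¬ maximalIdeal A ≤ K.radical →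
      ∀ P ∈ K.minimalPrimes, ¬ maximalIdeal A ≤ P := by
    intro K hK P hP hle
    apply hK
    rw [Ideal.radical_eq_sInf, le_sInf_iff]
    rintro Q ⟨hQ, hQp⟩
    have hPm : P ≤ maximalIdeal A := IsLocalRing.le_maximalIdeal hP.1.1.ne_top
    have hQP : Q ≤ P := (IsLocalRing.le_maximalIdeal hQp.ne_top).trans hle
    exact hle.trans (hP.2 ⟨hQp, hQ⟩ hQP)
  have hfin : (K₁.minimalPrimes ∪ K₂.minimalPrimes).Finite :=
    (K₁.finite_minimalPrimes_of_isNoetherianRing A).union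
      (K₂.finite_minimalPrimes_of_isNoetherianRing A)
  have hnot : ¬ ((maximalIdeal A : Set A) ⊆
      ⋃ P ∈ K₁.minimalPrimes ∪ K₂.minimalPrimes, ((id P : Ideal A) : Set A)) := by
    rw [Ideal.subset_union_prime_finite hfin (f := id) ⊥ ⊥]
    · rintro ⟨P, hP | hP, hle⟩
      · exact aux K₁ h₁ P hP hle
      · exact aux K₂ h₂ P hP hle
    · rintro P (hP | hP) _ _ <;> exact hP.1.1
  obtain ⟨y, hy, hyn⟩ := Set.not_subset.mp hnot
  simp only [Set.mem_iUnion, not_exists, id] at hyn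
  exact ⟨y, hy,
    maximalIdeal_le_radical_of_notMem_minimalPrimes hx hxK fun P hP => hyn P (Or.inl hP),
    maximalIdeal_le_radical_of_notMem_minimalPrimes hz hzK fun P hP => hyn P (Or.inr hP)⟩

/-- In a Cohen–Macaulay situation, every system of parameters is a regular sequence. -/
theorem Ideal.IsRegularModulo.of_parameters (n : ℕ) :
    ∀ (J : Ideal A) (xs zs : List A), xs.length = n → zs.length = n →
      (∀ x ∈ xs, x ∈ maximalIdeal A) → (∀ z ∈ zs, z ∈ maximalIdeal A) →
      maximalIdeal A ≤ (J ⊔ Ideal.ofList xs).radical →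
      maximalIdeal A ≤ (J ⊔ Ideal.ofList zs).radical →
      (∀ ws : List A, ws.length < n → (∀ w ∈ ws, w ∈ maximalIdeal A) →
        ¬ maximalIdeal A ≤ (J ⊔ Ideal.ofList ws).radical) →
      J.IsRegularModulo xs → J.IsRegularModulo zs := by
  induction n with
  | zero =>
    intro J xs zs _ hzs _ _ _ _ _ _
    rw [List.length_eq_zero_iff.mp hzs]
    trivial
  | succ n ih =>
    intro J xs zs hxl hzl hxm hzm hx hz hH hreg
    obtain ⟨xs, x, rfl⟩ := (List.eq_nil_or_concat' xs).resolve_left (by rintro rfl; simp at hxl)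
    obtain ⟨zs, z, rfl⟩ := (List.eq_nil_or_concat' zs).resolve_left (by rintro rfl; simp at hzl)
    simp only [List.length_append, List.length_singleton, add_left_inj] at hxl hzl
    simp only [Ideal.ofList_append, Ideal.ofList_singleton, ← sup_assoc] at hx hz
    have hxm' : ∀ a ∈ xs, a ∈ maximalIdeal A := fun a ha => hxm a (by simp [ha])
    have hzm' : ∀ a ∈ zs, a ∈ maximalIdeal A := fun a ha => hzm a (by simp [ha])
    obtain ⟨y, hy, hyx, hyz⟩ := exists_common_parameter (hxm x (by simp)) (hzm z (by simp)) hx hz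
      (hH xs (by omega) hxm') (hH zs (by omega) hzm')
    rw [append_singleton_iff] at hreg
    obtain ⟨k, hk⟩ := hyx (hxm x (by simp))
    have h₁ : J.IsRegularModulo (xs ++ [y]) :=
      (append_singleton_iff _ _ _).mpr ⟨hreg.1, regular_of_pow_mem hreg.2 hk⟩
    have h₂ : J.IsRegularModulo (y :: xs) := perm (List.perm_append_singleton y xs)
      (by
        simp only [List.mem_append, List.mem_singleton]
        rintro a (ha | rfl)
        exacts [hxm' a ha, hy]) h₁
    have h₃ : J.IsRegularModulo (y :: zs) := by
      refine ⟨h₂.1, ih _ xs zs hxl hzl hxm' hzm' (by rwa [sup_right_comm])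
        (by rwa [sup_right_comm]) (fun ws hws hwm => ?_) h₂.2⟩
      have := hH (y :: ws) (by simpa using hws) (by simpa using ⟨hy, hwm⟩)
      rwa [Ideal.ofList_cons, ← sup_assoc] at this
    have h₄ := perm (List.perm_append_singleton y zs).symm
      (by simp only [List.mem_cons]; rintro a (rfl | ha); exacts [hy, hzm' a ha]) h₃
    rw [append_singleton_iff] at h₄ ⊢
    obtain ⟨k, hk⟩ := hyz hy
    obtain ⟨k, hk⟩ := hz hy
    exact ⟨h₄.1, regular_of_pow_mem h₄.2 hk⟩
end

theorem Module.Basis.sumExtend_inl {ι K V : Type*} [DivisionRing K] [AddCommGroup V] [Module K V]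
    {v : ι → V} (hv : LinearIndependent K v) (i : ι) :
    Module.Basis.sumExtend hv (Sum.inl i) = v i := by
  simp only [Module.Basis.sumExtend, Module.Basis.reindex_apply]
  erw [Module.Basis.coe_extend, Equiv.Set.sumDiffSubset_apply_inl]
  · rfl
  · exact hv.linearIndepOn_id.subset_extend _

namespace Submodule

theorem eq_top_of_sup_smul_top_eq_top {R M : Type*} [CommRing R] [AddCommGroup M] [Module R M]
    {I : Ideal R} (hI : IsNilpotent I) {N : Submodule R M} (h : N ⊔ I • ⊤ = ⊤) : N = ⊤ := by
  obtain ⟨n, hn⟩ := hI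
  have : ∀ k : ℕ, N ⊔ I ^ k • (⊤ : Submodule R M) = ⊤ := by
    intro k
    induction k with
    | zero => simp
    | succ k ih =>
      have hle : I ^ k • (⊤ : Submodule R M) ≤ N ⊔ I ^ (k + 1) • ⊤ := by
        rw [pow_succ, mul_smul]
        conv_lhs => rw [← h]
        rw [Submodule.smul_sup]
        exact sup_le_sup_right Submodule.smul_le_right _
      refine top_le_iff.mp (ih.ge.trans ?_)
      exact sup_le le_sup_left hle
  simpa [hn] using this n

end Submodule

section

variable {R : Type*} [CommRing R] [IsLocalRing R]

open TensorProduct in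
theorem Module.exists_basis_of_flat_of_residueField_basis {M ι : Type*} [AddCommGroup M]
    [Module R M] [Module.Flat R M] (hm : IsNilpotent (maximalIdeal R)) (v : ι → M)
    (b : Module.Basis ι (ResidueField R) (ResidueField R ⊗[R] M)) (hv : ∀ i, b i = 1 ⊗ₜ[R] v i) :
    ∃ b' : Module.Basis ι R M, ∀ i, b' i = v i := by
  have hb : TensorProduct.mk R (ResidueField R) M 1 ∘ v = b := by
    ext i; simp [hv]
  have hli : LinearIndependent R v :=
    IsLocalRing.linearIndependent_of_flat v (hb ▸ b.linearIndependent)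
  have hsp : Submodule.span R (Set.range v) = ⊤ := by
    apply Submodule.eq_top_of_sup_smul_top_eq_top hm
    have htop : Submodule.span R (Set.range b) = ⊤ := by
      rw [← Submodule.restrictScalars_span R (ResidueField R) Ideal.Quotient.mk_surjective,
        b.span_eq, Submodule.restrictScalars_top]
    have hker : LinearMap.ker (TensorProduct.mk R (ResidueField R) M 1) = maximalIdeal R • ⊤ :=
      LinearMap.ker_tensorProductMk M
    rw [← hker, ← Submodule.comap_map_eq, Submodule.map_span, ← Set.range_comp, hb, htop,
      Submodule.comap_top]
  exact ⟨Module.Basis.mk hli hsp.ge, fun i => by simp⟩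

open TensorProduct in
theorem Module.free_of_flat_of_isNilpotent {M : Type*} [AddCommGroup M]
    [Module R M] [Module.Flat R M] (hm : IsNilpotent (maximalIdeal R)) : Module.Free R M := by
  let w := Module.Free.chooseBasis (ResidueField R) (ResidueField R ⊗[R] M)
  obtain ⟨v, hv⟩ :=
    (TensorProduct.mk_surjective R M (ResidueField R) Ideal.Quotient.mk_surjective).comp_left w
  obtain ⟨b, -⟩ := Module.exists_basis_of_flat_of_residueField_basis hm v w
    (fun i => (congrFun hv i).symm)
  exact Module.Free.of_basis b

open TensorProduct in
theorem Module.Flat.quotient_range_of_isNilpotent {M : Type*} [AddCommGroup M]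
    [Module R M] [Module.Flat R M] (hm : IsNilpotent (maximalIdeal R)) (f : M →ₗ[R] M)
    (hf : ∀ v, f v ∈ maximalIdeal R • (⊤ : Submodule R M) →
      v ∈ maximalIdeal R • (⊤ : Submodule R M)) :
    Module.Flat R (M ⧸ LinearMap.range f) := by
  let k := ResidueField R
  have hsurj := TensorProduct.mk_surjective R M k Ideal.Quotient.mk_surjective
  let e := Module.Free.chooseBasis k (k ⊗[R] M)
  obtain ⟨e', he'⟩ := hsurj.comp_left e
  have he' : ∀ i, e i = 1 ⊗ₜ[R] e' i := fun i => (congrFun he' i).symm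
  obtain ⟨E, hE⟩ := Module.exists_basis_of_flat_of_residueField_basis hm e' e he'
  have hmk : ∀ v : M, (1 : k) ⊗ₜ[R] v = 0 ↔ v ∈ maximalIdeal R • (⊤ : Submodule R M) := by
    intro v
    rw [← LinearMap.ker_tensorProductMk]; rfl
  have hinj : LinearMap.ker (f.baseChange k) = ⊥ := by
    rw [LinearMap.ker_eq_bot']
    intro x hx
    obtain ⟨v, rfl⟩ := hsurj x
    exact (hmk v).mpr (hf v ((hmk _).mp (by simpa using hx)))
  have hli := e.linearIndependent.map' _ hinj
  let b := Module.Basis.sumExtend hli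
  obtain ⟨b', hb'⟩ := hsurj.comp_left b
  have hb' : ∀ i, b i = 1 ⊗ₜ[R] b' i := fun i => (congrFun hb' i).symm
  let v : _ → M := Sum.elim (f ∘ e') (b' ∘ Sum.inr)
  obtain ⟨B, hB⟩ := Module.exists_basis_of_flat_of_residueField_basis hm v b (by
    rintro (i | i)
    · simp [v, b, Module.Basis.sumExtend_inl, he']
    · simp [v, hb'])
  have hrange : LinearMap.range f = Submodule.span R (B '' Set.range Sum.inl) := by
    rw [LinearMap.range_eq_map, ← E.span_eq, Submodule.map_span, ← Set.range_comp, ← Set.range_comp]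
    congr 2
    ext i
    simp [hE, hB, v]
  have hcompl : IsCompl (LinearMap.range f) (Submodule.span R (B '' Set.range Sum.inr)) := by
    rw [hrange]
    constructor
    · exact B.linearIndependent.disjoint_span_image Set.isCompl_range_inl_range_inr.disjoint
    · rw [codisjoint_iff, ← Submodule.span_union, ← Set.image_union,
        Set.range_inl_union_range_inr, Set.image_univ, B.span_eq]
  have hfree : Module.Free R (Submodule.span R (B '' Set.range Sum.inr)) := by
    rw [← Set.range_comp]
    exact Module.Free.of_basis (Module.Basis.span (B.linearIndependent.comp _ Sum.inr_injective))
  exact Module.Flat.of_linearEquiv (Submodule.quotientEquivOfIsCompl _ _ hcompl)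

theorem Module.Flat.quotient_ofList_of_isRegularModulo {S : Type*} [CommRing S] [Algebra R S]
    (hm : IsNilpotent (maximalIdeal R)) (l : List S) (J : Ideal S) [Module.Flat R (S ⧸ J)]
    (hl : (J ⊔ (maximalIdeal R).map (algebraMap R S)).IsRegularModulo l) :
    Module.Flat R (S ⧸ (J ⊔ Ideal.ofList l)) := by
  induction l generalizing J with
  | nil =>
    have h : J = J ⊔ Ideal.ofList [] := by simp
    exact Module.Flat.of_linearEquiv (Ideal.quotientEquivAlgOfEq R h).symm.toLinearEquiv
  | cons z l ih =>
    let f : (S ⧸ J) →ₗ[R] (S ⧸ J) := LinearMap.mulLeft R (Ideal.Quotient.mk J z)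
    have hmem : ∀ s : S, Ideal.Quotient.mk J s ∈ maximalIdeal R • (⊤ : Submodule R (S ⧸ J)) ↔
        s ∈ J ⊔ (maximalIdeal R).map (algebraMap R S) := by
      intro s
      rw [Ideal.smul_top_eq_map, Submodule.restrictScalars_mem,
        IsScalarTower.algebraMap_eq R S (S ⧸ J), ← Ideal.map_map, ← Ideal.mem_comap,
        Ideal.Quotient.algebraMap_eq, Ideal.comap_map_of_surjective' _ Ideal.Quotient.mk_surjective,
        Ideal.mk_ker, sup_comm]
    have hf := Module.Flat.quotient_range_of_isNilpotent hm f (by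
      intro v hv
      obtain ⟨s, rfl⟩ := Ideal.Quotient.mk_surjective v
      rw [LinearMap.mulLeft_apply, ← map_mul, hmem] at hv
      exact (hmem s).mpr (hl.1 s hv))
    have hle : J ≤ J ⊔ Ideal.span {z} := le_sup_left
    let g : (S ⧸ J) →ₗ[R] (S ⧸ (J ⊔ Ideal.span {z})) := (Ideal.Quotient.factorₐ R hle).toLinearMap
    have hg : Function.Surjective g := Ideal.Quotient.factor_surjective hle
    have hker : LinearMap.range f = LinearMap.ker g := by
      ext v
      obtain ⟨s, rfl⟩ := Ideal.Quotient.mk_surjective v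
      have : g (Ideal.Quotient.mk J s) = Ideal.Quotient.mk _ s := rfl
      rw [LinearMap.mem_ker, this, Ideal.Quotient.eq_zero_iff_mem]
      constructor
      · rintro ⟨w, hw⟩
        obtain ⟨t, rfl⟩ := Ideal.Quotient.mk_surjective w
        rw [LinearMap.mulLeft_apply, ← map_mul, eq_comm, Ideal.Quotient.eq] at hw
        rw [← sub_add_cancel s (z * t)]
        exact Submodule.add_mem_sup hw (Ideal.mem_span_singleton.mpr ⟨t, rfl⟩)
      · intro hs
        obtain ⟨j, hj, w, hw, rfl⟩ := Submodule.mem_sup.mp hs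
        obtain ⟨t, rfl⟩ := Ideal.mem_span_singleton.mp hw
        refine ⟨Ideal.Quotient.mk J t, ?_⟩
        rw [LinearMap.mulLeft_apply, ← map_mul, eq_comm, Ideal.Quotient.eq]
        simpa using hj
    have hflat : Module.Flat R (S ⧸ (J ⊔ Ideal.span {z})) :=
      Module.Flat.of_linearEquiv ((Submodule.quotEquivOfEq _ _ hker).trans
        (g.quotKerEquivOfSurjective hg)).symm
    have h : J ⊔ Ideal.ofList (z :: l) = J ⊔ Ideal.span {z} ⊔ Ideal.ofList l := by
      rw [Ideal.ofList_cons, sup_assoc]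
    have := ih (J ⊔ Ideal.span {z}) (by rw [sup_right_comm]; exact hl.2)
    exact Module.Flat.of_linearEquiv (Ideal.quotientEquivAlgOfEq R h).toLinearEquiv

theorem Module.mem_smul_top_of_smul_eq_zero {M : Type*} [AddCommGroup M] [Module R M]
    [Module.Free R M] {u : R} (hu : u ≠ 0) {w : M} (hw : u • w = 0) :
    w ∈ maximalIdeal R • (⊤ : Submodule R M) := by
  let b := Module.Free.chooseBasis R M
  rw [← b.linearCombination_repr w]
  refine Submodule.sum_mem _ fun i _ => Submodule.smul_mem_smul ?_ trivial
  rw [mem_maximalIdeal, mem_nonunits_iff]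
  intro hi
  have : u * b.repr w i = 0 := by
    have := congrArg (fun v => b.repr v i) hw
    simpa using this
  exact hu (hi.mul_left_eq_zero.mp this)

theorem Module.exists_smul_eq_of_maximalIdeal_smul_eq_zero {M : Type*} [AddCommGroup M]
    [Module R M] [Module.Free R M] {u : R}
    (hu : ∀ v : R, (∀ a ∈ maximalIdeal R, a * v = 0) → ∃ r, v = r * u) {y : M}
    (hy : ∀ a ∈ maximalIdeal R, a • y = 0) : ∃ w : M, y = u • w := by
  let b := Module.Free.chooseBasis R M
  have h : ∀ i, ∃ r, b.repr y i = r * u := fun i => hu _ fun a ha => by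
    have := congrArg (fun v => b.repr v i) (hy a ha)
    simpa using this
  choose r hr using h
  refine ⟨∑ i ∈ (b.repr y).support, r i • b i, ?_⟩
  conv_lhs => rw [← b.linearCombination_repr y]
  rw [Finsupp.linearCombination_apply, Finsupp.sum, Finset.smul_sum]
  exact Finset.sum_congr rfl fun i _ => by rw [hr, smul_smul, mul_comm]

end

section

variable {A : Type*} [CommRing A] [IsLocalRing A]

theorem IsFRational.isReduced {p : ℕ} (hp : 1 < p) (hA : IsFRational A p) {n : ℕ} {x : Fin n → A}
    (hx : IsSystemOfParameters A x) : IsReduced A := by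
  have hbot : (⊥ : Ideal A).IsParameterIdeal := ⟨n, 0, n.zero_le, x, hx, by simp⟩
  refine ⟨fun v ⟨k, hk⟩ => hA ⊥ hbot v
    ⟨1, fun P hP => (Ideal.ne_top_iff_one P).mp hP.1.1.ne_top, k, fun e he => ?_⟩⟩
  have hke : k ≤ p ^ e := he.trans (Nat.lt_pow_self hp).le
  rw [one_mul, pow_eq_zero_of_le hke hk]
  exact zero_mem _

theorem maximalIdeal_le_radical_of_mem_minimalPrimes {J : Ideal A}
    (h : maximalIdeal A ∈ J.minimalPrimes) : maximalIdeal A ≤ J.radical := by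
  rw [Ideal.radical_eq_sInf, le_sInf_iff]
  exact fun Q ⟨hQ, hQp⟩ => h.2 ⟨hQp, hQ⟩ (IsLocalRing.le_maximalIdeal hQp.ne_top)

theorem mem_minimalPrimes_of_maximalIdeal_le_radical {J : Ideal A} (hJ : J ≤ maximalIdeal A)
    (h : maximalIdeal A ≤ J.radical) : maximalIdeal A ∈ J.minimalPrimes :=
  ⟨⟨inferInstance, hJ⟩, fun _ hQ _ => h.trans (hQ.1.radical_le_iff.mpr hQ.2)⟩

theorem Ideal.isParameterIdeal_span_singleton [IsNoetherianRing A] {x : A}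
    (hx : x ∈ maximalIdeal A) (hreg : ∀ y, x * y = 0 → y = 0) :
    (Ideal.span {x}).IsParameterIdeal := by
  have hne : Ideal.span {x} ≠ ⊤ := fun h =>
    (IsLocalRing.maximalIdeal.isMaximal A).ne_top
      (top_le_iff.mp (h ▸ (Ideal.span_singleton_le_iff_mem _).mpr hx))
  have : Nontrivial (A ⧸ Ideal.span {x}) := Ideal.Quotient.nontrivial_iff.mpr hne
  have : IsLocalRing (A ⧸ Ideal.span {x}) :=
    IsLocalRing.of_surjective' _ (Ideal.Quotient.mk_surjective (I := Ideal.span {x}))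
  have hdim := ringKrullDim_quotient_span_singleton_succ_eq_ringKrullDim_of_mem_jacobson
    (isSMulRegular_iff_right_eq_zero_of_smul.mpr hreg)
    (IsLocalRing.ringJacobson_eq_maximalIdeal A ▸ hx)
  obtain ⟨s, hs, hcard⟩ :=
    (maximalIdeal (A ⧸ Ideal.span {x})).exists_finset_card_eq_height_of_isNoetherianRing
  rw [← maximalIdeal_height_eq_ringKrullDim, ← hcard] at hdim
  obtain ⟨y, hy⟩ := (Ideal.Quotient.mk_surjective (I := Ideal.span {x})).comp_left
    (fun i => (s.equivFin.symm i : A ⧸ Ideal.span {x}))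
  have hy : ∀ i, Ideal.Quotient.mk (Ideal.span {x}) (y i) = s.equivFin.symm i := congrFun hy
  have hrange : Set.range (Ideal.Quotient.mk (Ideal.span {x}) ∘ y) = s := by
    ext v
    simp only [Set.mem_range, Function.comp_apply, hy]
    exact ⟨by rintro ⟨i, rfl⟩; exact (s.equivFin.symm i).2,
      fun hv => ⟨s.equivFin ⟨v, hv⟩, by simp⟩⟩
  refine ⟨s.card + 1, 1, by omega, Fin.cons x y, ⟨?_, ?_, ?_⟩, ?_⟩
  · rw [← hdim]; rfl
  · refine Fin.cases (by simpa using hx) fun i => ?_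
    have : Ideal.Quotient.mk (Ideal.span {x}) (y i) ∈ maximalIdeal _ := by
      rw [hy]
      exact hs.1.2 (Ideal.subset_span (s.equivFin.symm i).2)
    rw [Fin.cons_succ, mem_maximalIdeal, mem_nonunits_iff]
    exact fun h => this (h.map _)
  · intro a ha
    have ha' : Ideal.Quotient.mk (Ideal.span {x}) a ∈ maximalIdeal _ :=
      have := IsLocalHom.of_surjective (Ideal.Quotient.mk (Ideal.span {x}))
        Ideal.Quotient.mk_surjective
      fun h => ha (this.1 a h)
    obtain ⟨k, hk⟩ := maximalIdeal_le_radical_of_mem_minimalPrimes hs ha'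
    refine ⟨k, ?_⟩
    rw [← hrange, Set.range_comp, ← Ideal.map_span, ← map_pow, ← Ideal.mem_comap,
      Ideal.comap_map_of_surjective' _ Ideal.Quotient.mk_surjective, Ideal.mk_ker] at hk
    rwa [Fin.range_cons, Ideal.span_insert, sup_comm]
  · congr 1
    ext v
    simp [eq_comm]

theorem IsFRational.isDomain [IsNoetherianRing A] {p : ℕ} (hp : 1 < p) (hA : IsFRational A p)
    {n : ℕ} {x : Fin n → A} (hx : IsSystemOfParameters A x) : IsDomain A := by
  have hred := hA.isReduced hp hx
  have hzero : ∀ y : A, (∀ P ∈ minimalPrimes A, y ∈ P) → y = 0 := by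
    intro y hy
    have : y ∈ sInf (minimalPrimes A) := Ideal.mem_sInf.mpr fun {P} hP => hy P hP
    rwa [minimalPrimes, Ideal.sInf_minimalPrimes, show (⊥ : Ideal A).radical = 0 from
      nilradical_eq_zero A] at this
  have hfin : (minimalPrimes A).Finite := minimalPrimes.finite_of_isNoetherianRing A
  obtain ⟨P, hP⟩ : (minimalPrimes A).Nonempty :=
    Set.nonempty_coe_sort.mp (Ideal.nonempty_minimalPrimes bot_ne_top)
  have hPp : P.IsPrime := hP.1.1
  have heq : ∀ {P Q : Ideal A}, P ∈ minimalPrimes A → Q ∈ minimalPrimes A → P ≤ Q → Q = P :=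
    fun hP hQ h => le_antisymm (hQ.2 hP.1 h) h
  suffices ∀ Q ∈ minimalPrimes A, Q = P by
    have hbot : P = ⊥ := (Submodule.eq_bot_iff _).mpr fun y hy =>
      hzero y fun Q hQ => this Q hQ ▸ hy
    rw [hbot] at hPp
    have : IsDomain (A ⧸ (⊥ : Ideal A)) := (Ideal.Quotient.isDomain_iff_prime _).mpr hPp
    exact (RingEquiv.quotientBot A).symm.isDomain
  intro Q hQ
  by_contra hQP
  have hQp : Q.IsPrime := hQ.1.1
  have hfin' : (minimalPrimes A \ {P}).Finite := hfin.sdiff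
  obtain ⟨a, haP, ha⟩ : ∃ a ∈ P, ∀ Q ∈ minimalPrimes A \ {P}, a ∉ Q := by
    have hnot : ¬ ((P : Set A) ⊆ ⋃ Q ∈ minimalPrimes A \ {P}, ((id Q : Ideal A) : Set A)) := by
      rw [Ideal.subset_union_prime_finite hfin' (f := id) ⊥ ⊥ fun Q hQ _ _ => hQ.1.1.1]
      rintro ⟨Q, hQ, hle⟩
      exact hQ.2 (heq hP hQ.1 hle)
    obtain ⟨a, haP, ha⟩ := Set.not_subset.mp hnot
    simp only [Set.mem_iUnion, not_exists, id] at ha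
    exact ⟨a, haP, ha⟩
  obtain ⟨b, hb, hbP⟩ : ∃ b, (∀ Q ∈ minimalPrimes A \ {P}, b ∈ Q) ∧ b ∉ P := by
    have hnot : ¬ (hfin'.toFinset.inf id ≤ P) := by
      rw [Ideal.IsPrime.inf_le' hPp]
      rintro ⟨Q, hQ, hle⟩
      have hQ := hfin'.mem_toFinset.mp hQ
      exact hQ.2 (heq hQ.1 hP hle).symm
    obtain ⟨b, hb, hbP⟩ := SetLike.not_le_iff_exists.mp hnot
    exact ⟨b, fun Q hQ => (Finset.inf_le (f := id) (hfin'.mem_toFinset.mpr hQ)) hb, hbP⟩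
  have hab : a * b = 0 := hzero _ fun Q' hQ' => by
    by_cases h : Q' = P
    · exact h ▸ P.mul_mem_right _ haP
    · exact Q'.mul_mem_left _ (hb Q' ⟨hQ', h⟩)
  have hcirc : a + b ∈ circComplement A := fun Q' hQ' hmem => by
    by_cases h : Q' = P
    · exact hbP ((P.add_mem_iff_right haP).mp (h ▸ hmem))
    · exact ha Q' ⟨hQ', h⟩ ((Q'.add_mem_iff_left (hb Q' ⟨hQ', h⟩)).mp hmem)
  have hreg : ∀ y, (a + b) * y = 0 → y = 0 := fun y hy => hzero y fun Q' hQ' =>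
    (hQ'.1.1.mem_or_mem (hy ▸ zero_mem Q')).resolve_left (hcirc Q' hQ')
  have hmem : a + b ∈ maximalIdeal A := add_mem (IsLocalRing.le_maximalIdeal hPp.ne_top haP)
    (IsLocalRing.le_maximalIdeal hQp.ne_top (hb Q ⟨hQ, hQP⟩))
  have hpow : ∀ k : ℕ, (a + b) ^ k * a = a ^ k * a := by
    intro k
    induction k with
    | zero => simp
    | succ k ih => linear_combination (a + b) * ih + a ^ k * hab
  obtain ⟨r, hr⟩ := Ideal.mem_span_singleton'.mp <|
    hA _ (Ideal.isParameterIdeal_span_singleton hmem hreg) a ⟨a + b, hcirc, 0, fun e _ => by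
      obtain ⟨k, hk⟩ := Nat.exists_eq_succ_of_ne_zero (pow_pos (by omega : 0 < p) e).ne'
      have : (a + b) * a ^ p ^ e = a * (a + b) ^ p ^ e := by
        rw [mul_comm a, hpow, hk, Nat.succ_eq_add_one]
        linear_combination a ^ k * hab
      rw [this]
      exact Ideal.mul_mem_left _ _
        (Ideal.subset_span ⟨a + b, Ideal.mem_span_singleton_self _, rfl⟩)⟩
  have hrP : r ∈ P := (hPp.mem_or_mem (x := r) (y := b) (by
    have : r * b = (1 - r) * a := by linear_combination hr
    exact this ▸ P.mul_mem_left _ haP)).resolve_right hbP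
  have hrQ : 1 - r ∈ Q := (hQp.mem_or_mem (x := 1 - r) (y := a) (by
    have : (1 - r) * a = r * b := by linear_combination -hr
    exact this ▸ Q.mul_mem_left _ (hb Q ⟨hQ, hQP⟩))).resolve_right (ha Q ⟨hQ, hQP⟩)
  refine (Ideal.ne_top_iff_one _).mp (IsLocalRing.maximalIdeal.isMaximal A).ne_top ?_
  rw [← sub_add_cancel 1 r]
  exact add_mem (IsLocalRing.le_maximalIdeal hQp.ne_top hrQ)
    (IsLocalRing.le_maximalIdeal hPp.ne_top hrP)

end

theorem Ideal.ofList_ofFn {A : Type*} [CommRing A] {n : ℕ} (x : Fin n → A) :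
    Ideal.ofList (List.ofFn x) = Ideal.span (Set.range x) := by
  simp [Ideal.ofList, List.mem_ofFn, Set.range]

section

variable {A : Type*} [CommRing A] [IsLocalRing A]

theorem IsSystemOfParameters.pow {d : ℕ} {z : Fin d → A} (hz : IsSystemOfParameters A z) {N : ℕ}
    (hN : 0 < N) : IsSystemOfParameters A fun i => z i ^ N := by
  refine ⟨hz.1, fun i => Ideal.pow_mem_of_mem _ (hz.2.1 i) N hN, hz.2.2.trans ?_⟩
  rw [Ideal.radical_le_radical_iff, Ideal.span_le]
  rintro _ ⟨i, rfl⟩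
  exact ⟨N, Ideal.subset_span ⟨i, rfl⟩⟩

theorem IsSystemOfParameters.isRegularModulo [IsNoetherianRing A] (hA : IsGorensteinLocalRing A)
    {d : ℕ} {z : Fin d → A} (hz : IsSystemOfParameters A z) :
    (⊥ : Ideal A).IsRegularModulo (List.ofFn z) := by
  classical
  obtain ⟨n, x, hx, hreg, -⟩ := hA
  obtain rfl : n = d := by
    have := hx.1.symm.trans hz.1
    exact_mod_cast this
  refine .of_parameters n ⊥ (List.ofFn x) (List.ofFn z) (by simp) (by simp)
    (fun a ha => ?_) (fun a ha => ?_) ?_ ?_ (fun ws hws hwm hle => ?_)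
    (.of_isWeaklyRegular hreg.toIsWeaklyRegular)
  · obtain ⟨i, rfl⟩ := (List.mem_ofFn' _ _).mp ha
    exact hx.2.1 i
  · obtain ⟨i, rfl⟩ := (List.mem_ofFn' _ _).mp ha
    exact hz.2.1 i
  · simpa [Ideal.ofList_ofFn] using hx.2.2
  · simpa [Ideal.ofList_ofFn] using hz.2.2
  · rw [bot_sup_eq] at hle
    have hspan : Ideal.ofList ws = Ideal.span (ws.toFinset : Set A) := by simp [Ideal.ofList]
    have hmin := mem_minimalPrimes_of_maximalIdeal_le_radical (J := Ideal.ofList ws)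
      (Ideal.span_le.mpr hwm) hle
    rw [hspan] at hmin
    have hheight : (maximalIdeal A).height = n := by
      have := maximalIdeal_height_eq_ringKrullDim (R := A)
      rw [hx.1] at this
      exact_mod_cast this
    have hcard : n ≤ ws.toFinset.card := by
      have := Ideal.height_le_card_of_mem_minimalPrimes_span_finset hmin
      rw [hheight] at this
      exact_mod_cast this
    have := ws.toFinset_card_le
    omega

end

section

universe u v

variable {R : Type u} {S : Type v} [CommRing R] [CommRing S] [IsLocalRing R] [Algebra R S]
  [Module.Flat R S]

/-- Over a zero-dimensional quotient of the base of a flat map, killing a sequence that is regular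
on the closed fibre yields a free algebra. -/
theorem exists_free_quotient {K : Ideal R} (hK : K ≠ ⊤) {n : ℕ} (hn : maximalIdeal R ^ n ≤ K)
    {l : List S} (hl : ((maximalIdeal R).map (algebraMap R S)).IsRegularModulo l) :
    ∃ (_ : IsLocalRing (R ⧸ K)) (B : Type v) (_ : CommRing B) (_ : Algebra (R ⧸ K) B)
      (_ : Module.Free (R ⧸ K) B) (π : S →+* B), Function.Surjective π ∧
      RingHom.ker π = K.map (algebraMap R S) ⊔ Ideal.ofList l ∧
      ∀ r, π (algebraMap R S r) = algebraMap (R ⧸ K) B (Ideal.Quotient.mk K r) := by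
  have : Nontrivial (R ⧸ K) := Ideal.Quotient.nontrivial_iff.mpr hK
  have hloc : IsLocalRing (R ⧸ K) :=
    IsLocalRing.of_surjective' _ (Ideal.Quotient.mk_surjective (I := K))
  let S' := S ⧸ K.map (algebraMap R S)
  have hmax : (maximalIdeal R).map (Ideal.Quotient.mk K) = maximalIdeal (R ⧸ K) :=
    IsLocalRing.map_maximalIdeal_of_surjective _ Ideal.Quotient.mk_surjective
  have hnil : IsNilpotent (maximalIdeal (R ⧸ K)) := by
    refine ⟨n, ?_⟩
    rw [← hmax, ← Ideal.map_pow, Ideal.zero_eq_bot, Ideal.map_eq_bot_iff_le_ker, Ideal.mk_ker]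
    exact hn
  have hflat : Module.Flat (R ⧸ K) S' :=
    Module.Flat.of_linearEquiv
      (Algebra.TensorProduct.quotIdealMapEquivQuotTensor S K).toLinearEquiv
  have hflat' : Module.Flat (R ⧸ K) (S' ⧸ (⊥ : Ideal S')) :=
    Module.Flat.of_linearEquiv (AlgEquiv.quotientBot (R ⧸ K) S').toLinearEquiv
  have hmap : (maximalIdeal (R ⧸ K)).map (algebraMap (R ⧸ K) S') =
      ((maximalIdeal R).map (algebraMap R S)).map (Ideal.Quotient.mk _) := by
    rw [← hmax, Ideal.map_map, Ideal.map_map]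
    rfl
  have hreg : ((⊥ : Ideal S') ⊔ (maximalIdeal (R ⧸ K)).map
      (algebraMap (R ⧸ K) S')).IsRegularModulo (l.map (Ideal.Quotient.mk _)) := by
    rw [← Ideal.IsRegularModulo.comap_iff Ideal.Quotient.mk_surjective, bot_sup_eq, hmap,
      Ideal.comap_map_of_surjective' _ Ideal.Quotient.mk_surjective, Ideal.mk_ker,
      sup_eq_left.mpr (Ideal.map_mono (IsLocalRing.le_maximalIdeal hK))]
    exact hl
  have hfl := Module.Flat.quotient_ofList_of_isRegularModulo hnil _ ⊥ hreg
  refine ⟨hloc, S' ⧸ ((⊥ : Ideal S') ⊔ Ideal.ofList (l.map (Ideal.Quotient.mk _))), inferInstance,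
    inferInstance, Module.free_of_flat_of_isNilpotent hnil,
    (Ideal.Quotient.mk _).comp (Ideal.Quotient.mk _),
    Ideal.Quotient.mk_surjective.comp Ideal.Quotient.mk_surjective, ?_, fun r => rfl⟩
  rw [← RingHom.comap_ker, Ideal.mk_ker, bot_sup_eq, ← Ideal.map_ofList,
    Ideal.comap_map_of_surjective' _ Ideal.Quotient.mk_surjective, Ideal.mk_ker, sup_comm]

theorem mem_map_maximalIdeal_sup_of_mul_mem {K : Ideal R} {n : ℕ} (hn : maximalIdeal R ^ n ≤ K)
    {l : List S} (hl : ((maximalIdeal R).map (algebraMap R S)).IsRegularModulo l) {u : R}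
    (hu : u ∉ K) {w : S}
    (hw : algebraMap R S u * w ∈ K.map (algebraMap R S) ⊔ Ideal.ofList l) :
    w ∈ (maximalIdeal R).map (algebraMap R S) ⊔ Ideal.ofList l := by
  have hK : K ≠ ⊤ := by rintro rfl; exact hu trivial
  obtain ⟨_, B, _, _, _, π, hπ, hker, hcomm⟩ := exists_free_quotient hK hn hl
  have hmax : (maximalIdeal R).map (Ideal.Quotient.mk K) = maximalIdeal (R ⧸ K) :=
    IsLocalRing.map_maximalIdeal_of_surjective _ Ideal.Quotient.mk_surjective
  have h := Module.mem_smul_top_of_smul_eq_zero (u := Ideal.Quotient.mk K u) (w := π w)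
    (by rwa [Ne, Ideal.Quotient.eq_zero_iff_mem])
    (by rwa [Algebra.smul_def, ← hcomm, ← map_mul, ← RingHom.mem_ker, hker])
  have hmap : (maximalIdeal (R ⧸ K)).map (algebraMap (R ⧸ K) B) =
      ((maximalIdeal R).map (algebraMap R S)).map π := by
    rw [← hmax, Ideal.map_map, Ideal.map_map]
    congr 1
    ext r
    exact (hcomm r).symm
  rw [Ideal.smul_top_eq_map, Submodule.restrictScalars_mem, hmap] at h
  have hcomap := Ideal.comap_map_of_surjective' π hπ ((maximalIdeal R).map (algebraMap R S))
  have hle : K.map (algebraMap R S) ≤ (maximalIdeal R).map (algebraMap R S) :=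
    Ideal.map_mono (IsLocalRing.le_maximalIdeal hK)
  rw [hker, ← sup_assoc, sup_of_le_left hle] at hcomap
  rw [← hcomap]
  exact h

theorem GeneratesSocle.exists_sub_mul_mem {K : Ideal R} {n : ℕ} (hn : maximalIdeal R ^ n ≤ K)
    {l : List S} (hl : ((maximalIdeal R).map (algebraMap R S)).IsRegularModulo l) {u : R}
    (hu : GeneratesSocle K u) {y : S}
    (hy : ∀ a ∈ maximalIdeal R, algebraMap R S a * y ∈ K.map (algebraMap R S) ⊔ Ideal.ofList l) :
    ∃ w, y - algebraMap R S u * w ∈ K.map (algebraMap R S) ⊔ Ideal.ofList l := by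
  have hK : K ≠ ⊤ := by rintro rfl; exact hu.2.1 trivial
  obtain ⟨_, B, _, _, _, π, hπ, hker, hcomm⟩ := exists_free_quotient hK hn hl
  have hmax : (maximalIdeal R).map (Ideal.Quotient.mk K) = maximalIdeal (R ⧸ K) :=
    IsLocalRing.map_maximalIdeal_of_surjective _ Ideal.Quotient.mk_surjective
  obtain ⟨w, hw⟩ := Module.exists_smul_eq_of_maximalIdeal_smul_eq_zero
    (u := Ideal.Quotient.mk K u) (y := π y) (fun v hv => by
      obtain ⟨v, rfl⟩ := Ideal.Quotient.mk_surjective v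
      obtain ⟨r, hr⟩ := hu.2.2 v (Submodule.mem_colon.mpr fun a ha => by
        have := hv _ (hmax ▸ Ideal.mem_map_of_mem _ ha)
        rwa [← map_mul, Ideal.Quotient.eq_zero_iff_mem, mul_comm] at this)
      exact ⟨Ideal.Quotient.mk K r, by rwa [← map_mul, Ideal.Quotient.eq]⟩)
    (fun a ha => by
      obtain ⟨a, ha', rfl⟩ :=
        (Ideal.mem_map_iff_of_surjective _ Ideal.Quotient.mk_surjective).mp (hmax ▸ ha)
      rw [Algebra.smul_def, ← hcomm, ← map_mul, ← RingHom.mem_ker, hker]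
      exact hy a ha')
  obtain ⟨w, rfl⟩ := hπ w
  refine ⟨w, ?_⟩
  rw [← hker, RingHom.mem_ker, map_sub, map_mul, hcomm, ← Algebra.smul_def, hw, sub_self]

end

section

variable {R : Type*} [CommRing R]

theorem Ideal.pow_mem_frobPow {I : Ideal R} {x : R} (hx : x ∈ I) (q : ℕ) : x ^ q ∈ I.frobPow q :=
  Ideal.subset_span ⟨x, hx, rfl⟩

theorem Ideal.frobPow_sup_span_le {S : Type*} [CommRing S] [Algebra R S] (p : ℕ) [Fact p.Prime]
    [CharP S p] (I : Ideal R) {ι : Type*} (z : ι → S) (e : ℕ) :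
    (I.map (algebraMap R S) ⊔ Ideal.span (Set.range z)).frobPow (p ^ e) ≤
      (I.frobPow (p ^ e)).map (algebraMap R S) ⊔ Ideal.span (Set.range fun i => z i ^ p ^ e) := by
  refine Ideal.span_le.mpr ?_
  rintro _ ⟨x, hx, rfl⟩
  suffices I.map (algebraMap R S) ⊔ Ideal.span (Set.range z) ≤
      ((I.frobPow (p ^ e)).map (algebraMap R S) ⊔
        Ideal.span (Set.range fun i => z i ^ p ^ e)).comap (iterateFrobenius S p e) from this hx
  refine sup_le (Ideal.map_le_iff_le_comap.mpr fun a ha => ?_) (Ideal.span_le.mpr ?_)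
  · rw [Ideal.mem_comap, Ideal.mem_comap, iterateFrobenius_def, ← map_pow]
    exact Ideal.mem_sup_left (Ideal.mem_map_of_mem _ (Ideal.pow_mem_frobPow ha _))
  · rintro _ ⟨i, rfl⟩
    rw [SetLike.mem_coe, Ideal.mem_comap, iterateFrobenius_def]
    exact Ideal.mem_sup_right (Ideal.subset_span ⟨i, rfl⟩)

theorem Ideal.exists_pow_le_frobPow [IsNoetherianRing R] {I J : Ideal R} {n : ℕ} (hn : J ^ n ≤ I)
    (q : ℕ) : ∃ k, J ^ k ≤ I.frobPow q :=
  Ideal.exists_pow_le_of_le_radical_of_fg (fun a ha => ⟨n * q, by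
    rw [pow_mul]
    exact Ideal.pow_mem_frobPow (hn (Ideal.pow_mem_pow ha n)) q⟩) (IsNoetherian.noetherian J)

theorem exists_maximalIdeal_pow_le_of_isFiniteLength [IsLocalRing R] {I : Ideal R}
    (hI : IsFiniteLength R (R ⧸ I)) : ∃ n, maximalIdeal R ^ n ≤ I := by
  rcases eq_or_ne I ⊤ with rfl | hne
  · exact ⟨0, le_top⟩
  have : Nontrivial (R ⧸ I) := Ideal.Quotient.nontrivial_iff.mpr hne
  have : IsLocalRing (R ⧸ I) :=
    IsLocalRing.of_surjective' _ (Ideal.Quotient.mk_surjective (I := I))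
  have := (isFiniteLength_iff_isNoetherian_isArtinian.mp hI).2
  have : IsArtinianRing (R ⧸ I) := isArtinian_of_tower R this
  obtain ⟨n, hn⟩ := IsArtinianRing.isNilpotent_jacobson_bot (R := R ⧸ I)
  refine ⟨n, ?_⟩
  rw [IsLocalRing.jacobson_eq_maximalIdeal _ bot_ne_top,
    ← IsLocalRing.map_maximalIdeal_of_surjective _ (Ideal.Quotient.mk_surjective (I := I)),
    ← Ideal.map_pow, Ideal.zero_eq_bot, Ideal.map_eq_bot_iff_le_ker, Ideal.mk_ker] at hn
  exact hn

theorem exists_mul_notMem_of_pow_le [IsLocalRing R] {S : Type*} [CommRing S] [Algebra R S]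
    {J : Ideal S} {n : ℕ} (hn : (maximalIdeal R ^ n).map (algebraMap R S) ≤ J) {x : S}
    (hx : x ∉ J) : ∃ r : R, algebraMap R S r * x ∉ J ∧
      ∀ a ∈ maximalIdeal R, algebraMap R S a * (algebraMap R S r * x) ∈ J := by
  classical
  have hex : ∃ k, ∀ a ∈ maximalIdeal R ^ k, algebraMap R S a * x ∈ J :=
    ⟨n, fun a ha => J.mul_mem_right _ (hn (Ideal.mem_map_of_mem _ ha))⟩
  obtain ⟨k, hk⟩ : ∃ k, Nat.find hex = k + 1 := Nat.exists_eq_succ_of_ne_zero fun h => by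
    have := (Nat.find_eq_zero hex).mp h 1 (by simp)
    exact hx (by simpa using this)
  have hmin := Nat.find_min hex (m := k) (by omega)
  have hspec := Nat.find_spec hex
  rw [hk] at hspec
  push Not at hmin
  obtain ⟨r, hr, hrx⟩ := hmin
  refine ⟨r, hrx, fun a ha => ?_⟩
  rw [← mul_assoc, ← map_mul]
  exact hspec _ (by rw [pow_succ']; exact Ideal.mul_mem_mul ha hr)

end

/-- **Proposition 3.2(1)** (Aberbach). Let `φ : (R,m,K) → (S,n,L)` be a flat local
homomorphism of Noetherian local rings of prime characteristic `p` with `S/mS` Gorenstein,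
let `z₁,…,z_d ∈ S` induce a system of parameters of `S/mS`, and let `I ⊆ R` with
`ℓ(R/I) < ∞` and one-dimensional socle which is Frobenius closed in `R`. If some
`c ∈ S − mS` is a test element for `S` and `S/mS` is F-rational, then `IS + (z)^[t]`
is tightly closed in `S` for every `t > 0`. -/
theorem tightlyClosed_extension_of_frobeniusClosed
    (p : ℕ) [Fact p.Prime]
    (R S : Type*) [CommRing R] [CommRing S]
    [IsNoetherianRing R] [IsNoetherianRing S]
    [IsLocalRing R] [IsLocalRing S] [CharP R p] [CharP S p]
    [Algebra R S] [Module.Flat R S] [IsLocalHom (algebraMap R S)]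
    [IsLocalRing (S ⧸ Ideal.map (algebraMap R S) (IsLocalRing.maximalIdeal R))]
    (hGor : IsGorensteinLocalRing (S ⧸ Ideal.map (algebraMap R S) (IsLocalRing.maximalIdeal R)))
    (d : ℕ) (z : Fin d → S)
    (hz : IsSystemOfParameters (S ⧸ Ideal.map (algebraMap R S) (IsLocalRing.maximalIdeal R))
      (fun i => Ideal.Quotient.mk (Ideal.map (algebraMap R S) (IsLocalRing.maximalIdeal R)) (z i)))
    (I : Ideal R) (hlen : IsFiniteLength R (R ⧸ I)) (hsoc : SocleDimOne I)
    (hFrob : I.IsFrobeniusClosed p)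
    (c : S) (hc : c ∉ Ideal.map (algebraMap R S) (IsLocalRing.maximalIdeal R))
    (hcS : IsTestElement p c)
    (hFrat : IsFRational (S ⧸ Ideal.map (algebraMap R S) (IsLocalRing.maximalIdeal R)) p) :
    ∀ t : ℕ, 0 < t →
      (Ideal.map (algebraMap R S) I ⊔
        Ideal.span (Set.range fun i => z i ^ t)).IsTightlyClosed p := by
  intro t ht x hx
  by_contra hxJ
  have hp : p.Prime := Fact.out
  let φ := Ideal.Quotient.mk (Ideal.map (algebraMap R S) (maximalIdeal R))
  have hφ : Function.Surjective φ := Ideal.Quotient.mk_surjective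
  have hker : RingHom.ker φ = (maximalIdeal R).map (algebraMap R S) := Ideal.mk_ker
  have hreg : ∀ N, 0 < N → ((maximalIdeal R).map (algebraMap R S)).IsRegularModulo
      (List.ofFn fun i => z i ^ N) := by
    intro N hN
    rw [← hker, RingHom.ker_eq_comap_bot, Ideal.IsRegularModulo.comap_iff hφ, List.map_ofFn]
    simpa [Function.comp_def] using (hz.pow hN).isRegularModulo hGor
  obtain ⟨n, hn⟩ := exists_maximalIdeal_pow_le_of_isFiniteLength hlen
  obtain ⟨u, hu⟩ := hsoc
  obtain ⟨r, hrx, hrm⟩ := exists_mul_notMem_of_pow_le ((Ideal.map_mono hn).trans le_sup_left) hxJ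
  obtain ⟨w, hw⟩ := hu.exists_sub_mul_mem hn (hreg t ht) (by rwa [Ideal.ofList_ofFn])
  rw [Ideal.ofList_ofFn] at hw
  have huw : algebraMap R S u * w ∉ Ideal.map (algebraMap R S) I ⊔
      Ideal.span (Set.range fun i => z i ^ t) := fun h => hrx (by simpa using add_mem hw h)
  have htest : ∀ e : ℕ, c * w ^ p ^ e ∈ (maximalIdeal R).map (algebraMap R S) ⊔
      Ideal.span (Set.range fun i => z i ^ (t * p ^ e)) := by
    intro e
    obtain ⟨k, hk⟩ := Ideal.exists_pow_le_frobPow hn (p ^ e)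
    rw [← Ideal.ofList_ofFn]
    refine mem_map_maximalIdeal_sup_of_mul_mem hk (hreg _ (Nat.mul_pos ht (pow_pos hp.pos e)))
      (u := u ^ p ^ e) (fun h => hu.2.1 (hFrob u ⟨e, h⟩)) ?_
    simp only [Ideal.ofList_ofFn, pow_mul]
    refine Ideal.frobPow_sup_span_le p I (fun i => z i ^ t) e ?_
    have key : algebraMap R S (u ^ p ^ e) * (c * w ^ p ^ e) =
        algebraMap R S r ^ p ^ e * (c * x ^ p ^ e) -
          c * (algebraMap R S r * x - algebraMap R S u * w) ^ p ^ e := by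
      rw [sub_pow_char_pow, map_pow]
      ring
    rw [key]
    exact sub_mem (Ideal.mul_mem_left _ _ (hcS.2 _ x hx e))
      (Ideal.mul_mem_left _ _ (Ideal.pow_mem_frobPow hw _))
  have hdom := hFrat.isDomain hp.one_lt hz
  have hspan : ∀ N, (Ideal.span (Set.range fun i => z i ^ N)).map φ =
      Ideal.span (Set.range fun i => φ (z i) ^ N) := by
    intro N
    rw [Ideal.map_span, ← Set.range_comp]
    simp [Function.comp_def]
  have hwt : φ w ∈ Ideal.span (Set.range fun i => φ (z i) ^ t) := by
    refine hFrat _ ⟨d, d, le_rfl, _, hz.pow ht, rfl⟩ _ ⟨φ c, fun P hP => ?_, 0, fun e _ => ?_⟩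
    · rw [IsDomain.minimalPrimes_eq_singleton_bot, Set.mem_singleton_iff] at hP
      rw [hP, Ideal.mem_bot, ← RingHom.mem_ker, hker]
      exact hc
    · have := Ideal.mem_map_of_mem φ (htest e)
      rw [Ideal.map_sup, hspan, (Ideal.map_eq_bot_iff_le_ker φ).mpr hker.ge, bot_sup_eq,
        map_mul, map_pow] at this
      refine (Ideal.span_le (I := Ideal.frobPow _ _)).mpr ?_ this
      rintro _ ⟨i, rfl⟩
      simp only [pow_mul]
      exact Ideal.pow_mem_frobPow (Ideal.subset_span (Set.mem_range_self i)) _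
  rw [← hspan, ← Ideal.mem_comap, Ideal.comap_map_of_surjective' φ hφ, hker] at hwt
  suffices Ideal.span (Set.range fun i => z i ^ t) ⊔ (maximalIdeal R).map (algebraMap R S) ≤
      Submodule.comap (LinearMap.mulLeft S (algebraMap R S u)) (Ideal.map (algebraMap R S) I ⊔
        Ideal.span (Set.range fun i => z i ^ t)) from huw (this hwt)
  refine sup_le (fun v hv => Ideal.mul_mem_left _ _ (Ideal.mem_sup_right hv))
    (Ideal.map_le_iff_le_comap.mpr fun a ha => Ideal.mem_sup_left ?_)
  rw [LinearMap.mulLeft_apply, ← map_mul]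
  exact Ideal.mem_map_of_mem _ (Submodule.mem_colon.mp hu.1 a ha)
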